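/- Let 1 ≤ d ≤ m and 1 ≤ r ≤ m+1−d, and assume that n_{d+r−1}·n_{d−1}·(n_i + n_j − 1) ≤ n_i·n_j·(n_{d+r−1} + n_{d−1} − 1) for every pair of indices d ≤ i < j ≤ d+r−2 (a condition that is vacuous when r ≤ 2). Then for any Cartesian set X = A_1 × ⋯ × A_m over F_q, d_r(C_{≤d}^{X,S}) = ∏_{i=1}^{d−1}(n_i − 1) · ∏_{i=d+r}^{m} n_i · (∏_{i=d}^{d+r−1} n_i − 1). -/

import Mathlib

/-- Square-free exponent vectors of total degree `d` in `m` variables. -/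
def Sd (m d : ℕ) : Set (Fin m → ℕ) := {a | (∀ i, a i ≤ 1) ∧ ∑ i, a i = d}

/-- Square-free exponent vectors of total degree at most `d` in `m` variables. -/
def Sle (m d : ℕ) : Set (Fin m → ℕ) := {a | (∀ i, a i ≤ 1) ∧ ∑ i, a i ≤ d}

/-- Evaluation code over the Cartesian set `X = A 0 × ⋯ × A (m-1)`, spanned by the
evaluations of the monomials `x^a` for `a ∈ S`. -/
noncomputable def evalCodeX {F : Type*} [Field F] {m : ℕ} (A : Fin m → Finset F)
    (S : Set (Fin m → ℕ)) :
    Submodule F ({P : Fin m → F // ∀ i, P i ∈ A i} → F) :=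
  Submodule.span F ((fun (a : Fin m → ℕ) (P : {P : Fin m → F // ∀ i, P i ∈ A i}) =>
    ∏ i, P.1 i ^ a i) '' S)

open Classical in
/-- Support of a linear code. -/
noncomputable def codeSupp {F ι : Type*} [Field F] [Fintype ι]
    (C : Submodule F (ι → F)) : Finset ι :=
  Finset.univ.filter (fun i => ∃ c ∈ C, c i ≠ 0)

/-- The `r`-th generalized Hamming weight of a linear code: the minimum cardinality of the
support of an `r`-dimensional subcode. -/
noncomputable def GHW {F ι : Type*} [Field F] [Fintype ι]
    (C : Submodule F (ι → F)) (r : ℕ) : ℕ :=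
  sInf {k | ∃ C' : Submodule F (ι → F),
    C' ≤ C ∧ Module.finrank F C' = r ∧ (codeSupp C').card = k}

/-- The footprint box `B_X = {0,…,n_1−1} × ⋯ × {0,…,n_m−1}`. -/
noncomputable def BX {F : Type*} {m : ℕ} (A : Fin m → Finset F) : Finset (Fin m → ℕ) :=
  Fintype.piFinset (fun i => Finset.range (A i).card)

open Classical in
/-- The shadow `∇_X(N)`: elements of `B_X` divisible by some element of `N`. -/
noncomputable def nablaX {F : Type*} {m : ℕ} (A : Fin m → Finset F)
    (N : Set (Fin m → ℕ)) : Finset (Fin m → ℕ) :=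
  (BX A).filter (fun b => ∃ a ∈ N, ∀ i, a i ≤ b i)

open Classical in
/-- The footprint `Δ_X(N) = B_X ∖ ∇_X(N)`. -/
noncomputable def deltaX {F : Type*} {m : ℕ} (A : Fin m → Finset F)
    (N : Set (Fin m → ℕ)) : Finset (Fin m → ℕ) :=
  (BX A).filter (fun b => ¬ ∃ a ∈ N, ∀ i, a i ≤ b i)

/-- `nval A k` is the cardinality `n_k = |A_k|`, with the paper's 1-based indexing
(junk value `1` outside the range `1 ≤ k ≤ m`). -/
def nval {F : Type*} {m : ℕ} (A : Fin m → Finset F) (k : ℕ) : ℕ :=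
  if h : 1 ≤ k ∧ k ≤ m then (A ⟨k - 1, by omega⟩).card else 1

/-- The value at `P` of the squarefree polynomial with coefficients `f`. -/
def multilinearEval (F : Type*) [Field F] (m : ℕ) :
    ((Fin m → Bool) → F) →ₗ[F] ((Fin m → F) → F) where
  toFun f P := ∑ c, f c * ∏ i, P i ^ (c i).toNat
  map_add' f g := by
    ext P
    simp [add_mul, Finset.sum_add_distrib]
  map_smul' t f := by
    ext P
    simp [Finset.mul_sum, mul_assoc]

lemma multilinearEval_apply {F : Type*} [Field F] {m : ℕ} (f : (Fin m → Bool) → F)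
    (P : Fin m → F) :
    multilinearEval F m f P = ∑ c, f c * ∏ i, P i ^ (c i).toNat := rfl

/-- The multiplicity of a support pattern `c` in a box with side lengths `n`. -/
def patternWeight {m : ℕ} (n : Fin m → ℕ) (c : Fin m → Bool) : ℕ :=
  ∏ i, bif c i then n i - 1 else 1

/-- Lexicographically leading exponents of the nonzero elements of `W`. -/
def leadingExponents {F : Type*} [Field F] {m : ℕ} (W : Submodule F ((Fin m → Bool) → F)) :
    Set (Fin m → Bool) :=
  {a | ∃ f ∈ W, f a ≠ 0 ∧ ∀ b, toLex a < toLex b → f b = 0}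

/-- Restriction of coefficients to the exponents whose first entry is `b`. -/
def headCoeff (F : Type*) [Field F] (m : ℕ) (b : Bool) :
    ((Fin (m + 1) → Bool) → F) →ₗ[F] ((Fin m → Bool) → F) :=
  LinearMap.funLeft F F (fun c => (Fin.cons b c : Fin (m + 1) → Bool))

lemma headCoeff_apply {F : Type*} [Field F] {m : ℕ} (b : Bool) (f : (Fin (m + 1) → Bool) → F)
    (c : Fin m → Bool) : headCoeff F m b f c = f (Fin.cons b c) := rfl

lemma sum_fin_succ_bool {M : Type*} [AddCommMonoid M] {m : ℕ} (g : (Fin (m + 1) → Bool) → M) :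
    ∑ c, g c =
      ∑ c : Fin m → Bool, g (Fin.cons true c) + ∑ c : Fin m → Bool, g (Fin.cons false c) := by
  rw [← Fintype.sum_equiv (Fin.consEquiv (fun _ : Fin (m + 1) => Bool))
    (fun x => g (Fin.cons x.1 x.2)) g (fun x => rfl), Fintype.sum_prod_type, Fintype.sum_bool]

lemma multilinearEval_cons {F : Type*} [Field F] {m : ℕ} (f : (Fin (m + 1) → Bool) → F)
    (x : F) (Q : Fin m → F) :
    multilinearEval F (m + 1) f (Fin.cons x Q) =
      x * multilinearEval F m (headCoeff F m true f) Q +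
        multilinearEval F m (headCoeff F m false f) Q := by
  simp only [multilinearEval_apply, headCoeff_apply]
  rw [sum_fin_succ_bool, Finset.mul_sum]
  simp only [Fin.prod_univ_succ, Fin.cons_zero, Fin.cons_succ, Bool.toNat_true, Bool.toNat_false,
    pow_one, pow_zero, one_mul]
  congr 1
  exact Finset.sum_congr rfl fun c _ => by ring

lemma patternWeight_cons {m : ℕ} (n : Fin (m + 1) → ℕ) (b : Bool) (c : Fin m → Bool) :
    patternWeight n (Fin.cons b c) =
      (bif b then n 0 - 1 else 1) * patternWeight (Fin.tail n) c := by
  simp [patternWeight, Fin.prod_univ_succ, Fin.tail]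

lemma toLex_cons_lt {m : ℕ} (b : Bool) {c e : Fin m → Bool} (h : toLex c < toLex e) :
    toLex (Fin.cons b c : Fin (m + 1) → Bool) < toLex (Fin.cons b e : Fin (m + 1) → Bool) :=
  (Fin.pi_lex_lt_cons_cons (α := fun _ => Bool) (fun x y => x < y)).2 (Or.inr ⟨rfl, h⟩)

lemma toLex_cons_false_lt_true {m : ℕ} (c e : Fin m → Bool) :
    toLex (Fin.cons false c : Fin (m + 1) → Bool) <
      toLex (Fin.cons true e : Fin (m + 1) → Bool) :=
  (Fin.pi_lex_lt_cons_cons (α := fun _ => Bool) (fun x y => x < y)).2 (Or.inl rfl)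

lemma leadingExponents_mono {F : Type*} [Field F] {m : ℕ}
    {V W : Submodule F ((Fin m → Bool) → F)} (h : V ≤ W) :
    leadingExponents V ⊆ leadingExponents W :=
  fun _ ⟨f, hf, h'⟩ => ⟨f, h hf, h'⟩

lemma mem_leadingExponents_of_cons_true {F : Type*} [Field F] {m : ℕ}
    {W : Submodule F ((Fin (m + 1) → Bool) → F)} {c : Fin m → Bool}
    (h : (Fin.cons true c : Fin (m + 1) → Bool) ∈ leadingExponents W) :
    c ∈ leadingExponents (W.map (headCoeff F m true)) := by
  obtain ⟨f, hf, hc, hlt⟩ := h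
  exact ⟨_, Submodule.mem_map_of_mem hf, hc, fun b hb => hlt _ (toLex_cons_lt true hb)⟩

lemma mem_leadingExponents_of_cons_false {F : Type*} [Field F] {m : ℕ}
    {W : Submodule F ((Fin (m + 1) → Bool) → F)} {c : Fin m → Bool}
    (h : (Fin.cons false c : Fin (m + 1) → Bool) ∈ leadingExponents W) :
    c ∈ leadingExponents
      ((W ⊓ LinearMap.ker (headCoeff F m true)).map (headCoeff F m false)) := by
  obtain ⟨f, hf, hc, hlt⟩ := h
  refine ⟨_, Submodule.mem_map_of_mem ⟨hf, ?_⟩, hc, fun b hb => hlt _ (toLex_cons_lt false hb)⟩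
  exact funext fun b => hlt _ (toLex_cons_false_lt_true c b)

open Classical in
/-- The upper closure of the leading exponents of `W`. -/
noncomputable def exponentShadow {F : Type*} [Field F] {m : ℕ}
    (W : Submodule F ((Fin m → Bool) → F)) : Finset (Fin m → Bool) :=
  Finset.univ.filter fun c => ∃ a ∈ leadingExponents W, a ≤ c

lemma mem_exponentShadow {F : Type*} [Field F] {m : ℕ}
    {W : Submodule F ((Fin m → Bool) → F)} {c : Fin m → Bool} :
    c ∈ exponentShadow W ↔ ∃ a ∈ leadingExponents W, a ≤ c := by
  simp [exponentShadow]

lemma isUpperSet_exponentShadow {F : Type*} [Field F] {m : ℕ}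
    (W : Submodule F ((Fin m → Bool) → F)) :
    IsUpperSet (exponentShadow W : Set (Fin m → Bool)) := by
  intro c e hce hc
  obtain ⟨a, ha, hac⟩ := mem_exponentShadow.1 hc
  exact mem_exponentShadow.2 ⟨a, ha, hac.trans hce⟩

open Classical in
/-- Points of `∏ i, A i` where some element of `W` does not vanish. -/
noncomputable def evalSupport {F : Type*} [Field F] {m : ℕ} (A : Fin m → Finset F)
    (W : Submodule F ((Fin m → Bool) → F)) : Finset (Fin m → F) :=
  (Fintype.piFinset A).filter fun P => ∃ f ∈ W, multilinearEval F m f P ≠ 0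

lemma mem_evalSupport {F : Type*} [Field F] {m : ℕ} {A : Fin m → Finset F}
    {W : Submodule F ((Fin m → Bool) → F)} {P : Fin m → F} :
    P ∈ evalSupport A W ↔ (∀ i, P i ∈ A i) ∧ ∃ f ∈ W, multilinearEval F m f P ≠ 0 := by
  simp [evalSupport]

lemma sum_exponentShadow_le {F : Type*} [Field F] {m : ℕ} (n : Fin (m + 1) → ℕ)
    (W : Submodule F ((Fin (m + 1) → Bool) → F))
    {V₀ V₁ : Submodule F ((Fin m → Bool) → F)}
    (h₀ : (W ⊓ LinearMap.ker (headCoeff F m true)).map (headCoeff F m false) ≤ V₀)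
    (h₀₁ : V₀ ≤ V₁) (h₁ : W.map (headCoeff F m true) ≤ V₁) :
    ∑ c ∈ exponentShadow W, patternWeight n c ≤
      ∑ c ∈ exponentShadow V₀, patternWeight (Fin.tail n) c +
        (n 0 - 1) * ∑ c ∈ exponentShadow V₁, patternWeight (Fin.tail n) c := by
  classical
  have key : ∀ b c, (Fin.cons b c : Fin (m + 1) → Bool) ∈ exponentShadow W →
      c ∈ exponentShadow (bif b then V₁ else V₀) := by
    intro b c h
    obtain ⟨a, ha, hac⟩ := mem_exponentShadow.1 h
    rw [← Fin.cons_self_tail a] at ha hac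
    have htail : Fin.tail a ≤ c := fun i => by simpa using hac i.succ
    have hhead : a 0 ≤ b := by simpa using hac 0
    refine mem_exponentShadow.2 ⟨Fin.tail a, ?_, htail⟩
    cases h0 : a 0
    · rw [h0] at ha
      have := leadingExponents_mono h₀ (mem_leadingExponents_of_cons_false ha)
      cases b
      · exact this
      · exact leadingExponents_mono h₀₁ this
    · rw [h0] at ha hhead
      cases b
      · exact absurd hhead (by decide)
      · exact leadingExponents_mono h₁ (mem_leadingExponents_of_cons_true ha)
  have hsplit := sum_fin_succ_bool
    (fun c => if c ∈ exponentShadow W then patternWeight n c else 0)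
  rw [Finset.sum_ite_mem, Finset.univ_inter] at hsplit
  rw [hsplit, add_comm, Finset.mul_sum]
  refine Nat.add_le_add ?_ ?_
  · rw [← Finset.univ_inter (exponentShadow V₀), ← Finset.sum_ite_mem]
    refine Finset.sum_le_sum fun c _ => ?_
    split_ifs with h h'
    · simp [patternWeight_cons]
    · exact absurd (key false c h) h'
    · exact Nat.zero_le _
    · exact le_rfl
  · rw [← Finset.univ_inter (exponentShadow V₁), ← Finset.sum_ite_mem]
    refine Finset.sum_le_sum fun c _ => ?_
    split_ifs with h h'
    · simp [patternWeight_cons]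
    · exact absurd (key true c h) h'
    · exact Nat.zero_le _
    · exact le_rfl

lemma card_evalSupport_ge {F : Type*} [Field F] {m : ℕ} (A : Fin (m + 1) → Finset F)
    (hA : (A 0).Nonempty) (W : Submodule F ((Fin (m + 1) → Bool) → F))
    {V₀ V₁ : Submodule F ((Fin m → Bool) → F)}
    (h₀ : V₀ = (W ⊓ LinearMap.ker (headCoeff F m true)).map (headCoeff F m false))
    (h₁ : V₁ = V₀ ⊔ W.map (headCoeff F m true)) :
    (evalSupport (Fin.tail A) V₀).card +
      ((A 0).card - 1) * (evalSupport (Fin.tail A) V₁).card ≤ (evalSupport A W).card := by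
  classical
  set S₀ := evalSupport (Fin.tail A) V₀
  set S₁ := evalSupport (Fin.tail A) V₁
  have hS : S₀ ⊆ S₁ := by
    intro Q hQ
    obtain ⟨hQA, f, hf, hfQ⟩ := mem_evalSupport.1 hQ
    exact mem_evalSupport.2 ⟨hQA, f, h₁ ▸ Submodule.mem_sup_left hf, hfQ⟩
  have hmaps : Set.MapsTo (Fin.tail : (Fin (m + 1) → F) → Fin m → F) (evalSupport A W)
      (Fintype.piFinset (Fin.tail A)) := by
    intro P hP
    exact Fintype.mem_piFinset.2 fun i => (mem_evalSupport.1 hP).1 i.succ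
  have hmem : ∀ Q ∈ S₁, ∀ x ∈ A 0, (∃ f ∈ W, multilinearEval F (m + 1) f (Fin.cons x Q) ≠ 0) →
      (Fin.cons x Q : Fin (m + 1) → F) ∈ (evalSupport A W).filter (fun P => Fin.tail P = Q) := by
    intro Q hQ x hx hf
    refine Finset.mem_filter.2 ⟨mem_evalSupport.2 ⟨fun i => ?_, hf⟩, Fin.tail_cons _ _⟩
    refine Fin.cases ?_ (fun j => ?_) i
    · simpa using hx
    · exact (mem_evalSupport.1 hQ).1 j
  have hfib : ∀ Q ∈ S₁, ∀ s ⊆ A 0,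
      (∀ x ∈ s, ∃ f ∈ W, multilinearEval F (m + 1) f (Fin.cons x Q) ≠ 0) →
      s.card ≤ ((evalSupport A W).filter (fun P => Fin.tail P = Q)).card := by
    intro Q hQ s hs hf
    refine Finset.card_le_card_of_injOn (fun x => (Fin.cons x Q : Fin (m + 1) → F))
      (fun x hx => hmem Q hQ x (hs hx) (hf x hx)) fun x _ y _ hxy => ?_
    simpa using congrFun hxy 0
  have hcount : ∀ Q ∈ S₁, (if Q ∈ S₀ then 1 else 0) + ((A 0).card - 1) ≤
      ((evalSupport A W).filter (fun P => Fin.tail P = Q)).card := by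
    intro Q hQ
    by_cases hQ0 : Q ∈ S₀
    · obtain ⟨-, g, hg, hgQ⟩ := mem_evalSupport.1 hQ0
      rw [h₀] at hg
      obtain ⟨f, ⟨hfW, hfk⟩, rfl⟩ := hg
      have := hfib Q hQ (A 0) subset_rfl fun x _ => ⟨f, hfW, by
        rw [multilinearEval_cons, LinearMap.mem_ker.1 hfk]
        simpa using hgQ⟩
      have := hA.card_pos
      simp only [hQ0, if_true]
      omega
    · obtain ⟨hQA, k, hk, hkQ⟩ := mem_evalSupport.1 hQ
      rw [h₁] at hk
      obtain ⟨g, hg, h, hh, rfl⟩ := Submodule.mem_sup.1 hk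
      obtain ⟨f, hfW, rfl⟩ := hh
      have hgQ : multilinearEval F m g Q = 0 := by
        by_contra hne
        exact hQ0 (mem_evalSupport.2 ⟨hQA, g, hg, hne⟩)
      rw [map_add, Pi.add_apply, hgQ, zero_add] at hkQ
      set u := multilinearEval F m (headCoeff F m true f) Q
      set v := multilinearEval F m (headCoeff F m false f) Q
      have := hfib Q hQ ((A 0).erase (-v / u)) (Finset.erase_subset _ _) fun x hx =>
        ⟨f, hfW, by
          rw [multilinearEval_cons]
          intro h0
          exact Finset.ne_of_mem_erase hx (by
            rw [eq_div_iff hkQ]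
            exact eq_neg_of_add_eq_zero_left h0)⟩
      have h2 := Finset.pred_card_le_card_erase (s := A 0) (a := -v / u)
      simp only [hQ0, if_false]
      omega
  rw [Finset.card_eq_sum_card_fiberwise hmaps]
  calc S₀.card + ((A 0).card - 1) * S₁.card
      = ∑ Q ∈ S₁, ((if Q ∈ S₀ then 1 else 0) + ((A 0).card - 1)) := by
        rw [Finset.sum_add_distrib, Finset.sum_ite_mem, Finset.inter_eq_right.2 hS]
        simp [mul_comm]
    _ ≤ ∑ Q ∈ S₁, ((evalSupport A W).filter (fun P => Fin.tail P = Q)).card :=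
        Finset.sum_le_sum hcount
    _ ≤ _ := Finset.sum_le_sum_of_subset fun Q hQ =>
        Fintype.mem_piFinset.2 (mem_evalSupport.1 hQ).1

/-- Footprint bound: the support of `W` on a box is at least the weight of the shadow of its
leading exponents. -/
lemma sum_exponentShadow_le_card_evalSupport {F : Type*} [Field F] {m : ℕ}
    (A : Fin m → Finset F) (hA : ∀ i, (A i).Nonempty) (W : Submodule F ((Fin m → Bool) → F)) :
    ∑ c ∈ exponentShadow W, patternWeight (fun i => (A i).card) c ≤ (evalSupport A W).card := by
  induction m with
  | zero =>
    rcases (exponentShadow W).eq_empty_or_nonempty with h | ⟨c, hc⟩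
    · simp [h]
    · obtain ⟨a, ⟨f, hf, hfa, -⟩, -⟩ := mem_exponentShadow.1 hc
      have h1 : (default : Fin 0 → F) ∈ evalSupport A W :=
        mem_evalSupport.2 ⟨fun i => i.elim0, f, hf, by
          rw [multilinearEval_apply, Fintype.sum_subsingleton _ a]
          simpa only [Finset.univ_eq_empty, Finset.prod_empty, mul_one] using hfa⟩
      calc _ ≤ ∑ _c : Fin 0 → Bool, 1 := Finset.sum_le_sum_of_subset_of_nonneg
              (Finset.subset_univ _) (fun _ _ _ => Nat.zero_le _) |>.trans
                (Finset.sum_le_sum fun c _ => by simp [patternWeight])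
        _ = 1 := by simp
        _ ≤ _ := Finset.card_pos.2 ⟨_, h1⟩
  | succ m ih =>
    refine (sum_exponentShadow_le _ W le_rfl le_sup_left le_sup_right).trans
      (le_trans ?_ (card_evalSupport_ge A (hA 0) W rfl rfl))
    exact Nat.add_le_add (ih (Fin.tail A) (fun i => hA i.succ) _)
      (Nat.mul_le_mul_left _ (ih (Fin.tail A) (fun i => hA i.succ) _))

lemma finrank_le_card_leadingExponents {F : Type*} [Field F] {m : ℕ}
    (W : Submodule F ((Fin m → Bool) → F)) :
    Module.finrank F W ≤ Nat.card (leadingExponents W) := by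
  classical
  have hinj : Function.Injective
      ((LinearMap.funLeft F F ((↑) : leadingExponents W → (Fin m → Bool))) ∘ₗ W.subtype) := by
    rw [← LinearMap.ker_eq_bot, LinearMap.ker_eq_bot']
    rintro ⟨f, hf⟩ h0
    by_contra hne
    have hsupp : (Finset.univ.filter fun c => f c ≠ 0).Nonempty := by
      by_contra hemp
      refine hne (Subtype.ext (funext fun c => ?_))
      by_contra hc
      exact hemp ⟨c, by simpa using hc⟩
    obtain ⟨a, ha, hmax⟩ := Finset.exists_max_image _ toLex hsupp
    have hfa : f a ≠ 0 := by simpa using ha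
    have hlead : a ∈ leadingExponents W := ⟨f, hf, hfa, fun b hb => by
      by_contra hfb
      exact absurd (hmax b (by simpa using hfb)) (not_le.2 hb)⟩
    exact hfa (congrFun h0 ⟨a, hlead⟩)
  have := LinearMap.finrank_le_finrank_of_injective hinj
  rwa [Module.finrank_fintype_fun_eq_card, ← Nat.card_eq_fintype_card] at this

/-- The number of `true` entries. -/
def patternSize {m : ℕ} (c : Fin m → Bool) : ℕ := ∑ i, (c i).toNat

/-- `c` with the entries `i` and `j` exchanged. -/
def swapEntries {m : ℕ} (i j : Fin m) (c : Fin m → Bool) : Fin m → Bool :=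
  c ∘ Equiv.swap i j

lemma swapEntries_swapEntries {m : ℕ} (i j : Fin m) (c : Fin m → Bool) :
    swapEntries i j (swapEntries i j c) = c := by
  ext k
  simp [swapEntries]

lemma swapEntries_apply_left {m : ℕ} (i j : Fin m) (c : Fin m → Bool) :
    swapEntries i j c i = c j := by
  simp [swapEntries]

lemma swapEntries_apply_right {m : ℕ} (i j : Fin m) (c : Fin m → Bool) :
    swapEntries i j c j = c i := by
  simp [swapEntries]

lemma swapEntries_apply_of_ne {m : ℕ} {i j k : Fin m} (hi : k ≠ i) (hj : k ≠ j)
    (c : Fin m → Bool) : swapEntries i j c k = c k := by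
  simp [swapEntries, Equiv.swap_apply_of_ne_of_ne hi hj]

lemma swapEntries_mono {m : ℕ} (i j : Fin m) : Monotone (swapEntries i j) :=
  fun _ _ h k => h (Equiv.swap i j k)

lemma swapEntries_eq_self {m : ℕ} {i j : Fin m} {c : Fin m → Bool} (h : c i = c j) :
    swapEntries i j c = c := by
  ext k
  by_cases hi : k = i
  · rw [hi, swapEntries_apply_left, h]
  by_cases hj : k = j
  · rw [hj, swapEntries_apply_right, h]
  rw [swapEntries_apply_of_ne hi hj]

lemma patternSize_swapEntries {m : ℕ} (i j : Fin m) (c : Fin m → Bool) :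
    patternSize (swapEntries i j c) = patternSize c :=
  Equiv.sum_comp (Equiv.swap i j) (fun k => (c k).toNat)

/-- The left shift of a pattern with respect to the family `U`. -/
def shiftPattern {m : ℕ} (U : Finset (Fin m → Bool)) (i j : Fin m) (c : Fin m → Bool) :
    Fin m → Bool :=
  if c j = true ∧ c i = false ∧ swapEntries i j c ∉ U then swapEntries i j c else c

lemma shiftPattern_injOn {m : ℕ} (U : Finset (Fin m → Bool)) (i j : Fin m) :
    Set.InjOn (shiftPattern U i j) U := by
  intro c hc e he h
  simp only [shiftPattern] at h
  split_ifs at h with h1 h2 h2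
  · rw [← swapEntries_swapEntries i j c, h, swapEntries_swapEntries]
  · exact absurd (h ▸ he) h1.2.2
  · exact absurd (h ▸ hc) h2.2.2
  · exact h

lemma patternSize_shiftPattern {m : ℕ} (U : Finset (Fin m → Bool)) (i j : Fin m)
    (c : Fin m → Bool) : patternSize (shiftPattern U i j c) = patternSize c := by
  simp only [shiftPattern]
  split_ifs
  · exact patternSize_swapEntries i j c
  · rfl

/-- The left shift of a family of patterns. -/
def shiftFamily {m : ℕ} (U : Finset (Fin m → Bool)) (i j : Fin m) : Finset (Fin m → Bool) :=
  U.image (shiftPattern U i j)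

lemma mem_shiftFamily {m : ℕ} {U : Finset (Fin m → Bool)} {i j : Fin m} {e : Fin m → Bool} :
    e ∈ shiftFamily U i j ↔ (e ∈ U ∧ swapEntries i j e ∈ U) ∨
      (e i = true ∧ (e ∈ U ∨ swapEntries i j e ∈ U)) := by
  simp only [shiftFamily, Finset.mem_image]
  constructor
  · rintro ⟨c, hc, rfl⟩
    simp only [shiftPattern]
    split_ifs with h
    · exact Or.inr ⟨by rw [swapEntries_apply_left, h.1],
        Or.inr (by rwa [swapEntries_swapEntries])⟩
    · by_cases hi : c i = true
      · exact Or.inr ⟨hi, Or.inl hc⟩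
      · by_cases hs : swapEntries i j c ∈ U
        · exact Or.inl ⟨hc, hs⟩
        · rw [Bool.not_eq_true] at hi
          have hj : c j = false := by
            by_contra hj
            exact h ⟨by simpa using hj, hi, hs⟩
          exact absurd (by rwa [swapEntries_eq_self (hi.trans hj.symm)]) hs
  · intro h
    by_cases he : e ∈ U
    · refine ⟨e, he, if_neg ?_⟩
      rintro ⟨-, hi, hs⟩
      rcases h with h | h
      · exact hs h.2
      · rw [hi] at h
        exact absurd h.1 (by decide)
    · have hs : e i = true ∧ swapEntries i j e ∈ U := by tauto
      have hj : e j = false := by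
        by_contra hj
        rw [Bool.not_eq_false] at hj
        exact he (swapEntries_eq_self (hs.1.trans hj.symm) ▸ hs.2)
      refine ⟨swapEntries i j e, hs.2, ?_⟩
      rw [shiftPattern, if_pos, swapEntries_swapEntries]
      rw [swapEntries_apply_right, swapEntries_apply_left, swapEntries_swapEntries]
      exact ⟨hs.1, hj, he⟩

lemma isUpperSet_shiftFamily {m : ℕ} {U : Finset (Fin m → Bool)} (i j : Fin m)
    (hU : IsUpperSet (U : Set (Fin m → Bool))) :
    IsUpperSet (shiftFamily U i j : Set (Fin m → Bool)) := by
  intro c e hce hc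
  have h1 : c ∈ U → e ∈ U := fun h => hU hce h
  have h2 : swapEntries i j c ∈ U → swapEntries i j e ∈ U :=
    fun h => hU (swapEntries_mono i j hce) h
  have h3 : c i = true → e i = true := fun h => by
    exact Bool.eq_true_of_true_le (h ▸ hce i)
  rw [Finset.mem_coe, mem_shiftFamily] at hc ⊢
  tauto

lemma card_filter_shiftFamily {m : ℕ} (U : Finset (Fin m → Bool)) (i j : Fin m) (d : ℕ) :
    ((shiftFamily U i j).filter fun c => patternSize c ≤ d).card =
      (U.filter fun c => patternSize c ≤ d).card := by
  rw [shiftFamily, Finset.filter_image, Finset.card_image_of_injOn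
    ((shiftPattern_injOn U i j).mono fun c hc => (Finset.mem_filter.1 hc).1)]
  simp only [patternSize_shiftPattern]

lemma sum_shiftFamily {m : ℕ} (U : Finset (Fin m → Bool)) (i j : Fin m)
    (v : (Fin m → Bool) → ℕ) :
    ∑ c ∈ shiftFamily U i j, v c = ∑ c ∈ U, v (shiftPattern U i j c) :=
  Finset.sum_image (shiftPattern_injOn U i j)

lemma patternWeight_swapEntries_le {m : ℕ} {n : Fin m → ℕ} {i j : Fin m}
    (hij : i ≠ j) (hle : n i ≤ n j) {c : Fin m → Bool} (hj : c j = true) (hi : c i = false) :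
    patternWeight n (swapEntries i j c) ≤ patternWeight n c := by
  have split : ∀ e : Fin m → Bool, patternWeight n e =
      (bif e i then n i - 1 else 1) * ((bif e j then n j - 1 else 1) *
        ∏ k ∈ (Finset.univ.erase i).erase j, bif e k then n k - 1 else 1) := fun e => by
    rw [patternWeight, ← Finset.mul_prod_erase _ _ (Finset.mem_univ i),
      ← Finset.mul_prod_erase _ _ (Finset.mem_erase.2 ⟨hij.symm, Finset.mem_univ j⟩)]
  rw [split, split c, swapEntries_apply_left, swapEntries_apply_right, hj, hi]
  have : ∏ k ∈ (Finset.univ.erase i).erase j, (bif swapEntries i j c k then n k - 1 else 1) =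
      ∏ k ∈ (Finset.univ.erase i).erase j, bif c k then n k - 1 else 1 := by
    refine Finset.prod_congr rfl fun k hk => ?_
    simp only [Finset.mem_erase] at hk
    rw [swapEntries_apply_of_ne hk.2.1 hk.1]
  rw [this]
  simp only [cond_true, cond_false, one_mul]
  exact Nat.mul_le_mul_right _ (by omega)

/-- The sum of the positions of the `true` entries. -/
def positionSum {m : ℕ} (c : Fin m → Bool) : ℕ := ∑ i, (c i).toNat * (i : ℕ)

lemma positionSum_swapEntries_lt {m : ℕ} {i j : Fin m} (hij : i < j) {c : Fin m → Bool}
    (hj : c j = true) (hi : c i = false) :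
    positionSum (swapEntries i j c) < positionSum c := by
  have split : ∀ e : Fin m → Bool, positionSum e =
      (e i).toNat * i + ((e j).toNat * j +
        ∑ k ∈ (Finset.univ.erase i).erase j, (e k).toNat * (k : ℕ)) := fun e => by
    rw [positionSum, ← Finset.add_sum_erase _ _ (Finset.mem_univ i),
      ← Finset.add_sum_erase _ _ (Finset.mem_erase.2 ⟨hij.ne', Finset.mem_univ j⟩)]
  rw [split, split c, swapEntries_apply_left, swapEntries_apply_right, hj, hi]
  have : ∑ k ∈ (Finset.univ.erase i).erase j, (swapEntries i j c k).toNat * (k : ℕ) =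
      ∑ k ∈ (Finset.univ.erase i).erase j, (c k).toNat * (k : ℕ) := by
    refine Finset.sum_congr rfl fun k hk => ?_
    simp only [Finset.mem_erase] at hk
    rw [swapEntries_apply_of_ne hk.2.1 hk.1]
  rw [this]
  have : (i : ℕ) < j := hij
  simp only [Bool.toNat_true, Bool.toNat_false]
  omega

/-- A family of patterns is left compressed if moving an entry to the left stays inside it. -/
def IsLeftCompressed {m : ℕ} (U : Finset (Fin m → Bool)) : Prop :=
  ∀ i j : Fin m, i < j → ∀ c ∈ U, c j = true → c i = false → swapEntries i j c ∈ U

/-- Shifting reduces an upper set to a left compressed one without increasing its weight. -/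
lemma exists_isLeftCompressed {m : ℕ} {n : Fin m → ℕ} (hmono : Monotone n)
    (d : ℕ) (U : Finset (Fin m → Bool)) (hU : IsUpperSet (U : Set (Fin m → Bool))) :
    ∃ V : Finset (Fin m → Bool), IsUpperSet (V : Set (Fin m → Bool)) ∧ IsLeftCompressed V ∧
      (V.filter fun c => patternSize c ≤ d).card = (U.filter fun c => patternSize c ≤ d).card ∧
      ∑ c ∈ V, patternWeight n c ≤ ∑ c ∈ U, patternWeight n c := by
  induction hk : ∑ c ∈ U, positionSum c using Nat.strong_induction_on generalizing U with
  | _ k ih =>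
  by_cases hc : IsLeftCompressed U
  · exact ⟨U, hU, hc, rfl, le_rfl⟩
  simp only [IsLeftCompressed, not_forall] at hc
  obtain ⟨i, j, hij, c, hcU, hcj, hci, hsw⟩ := hc
  have hlt : ∑ c ∈ shiftFamily U i j, positionSum c < k := by
    rw [sum_shiftFamily, ← hk]
    refine Finset.sum_lt_sum (fun e _ => ?_) ⟨c, hcU, ?_⟩
    · simp only [shiftPattern]
      split_ifs with h
      · exact (positionSum_swapEntries_lt hij h.1 h.2.1).le
      · exact le_rfl
    · rw [shiftPattern, if_pos ⟨hcj, hci, hsw⟩]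
      exact positionSum_swapEntries_lt hij hcj hci
  obtain ⟨V, hV, hVc, hVn, hVw⟩ := ih _ hlt _ (isUpperSet_shiftFamily i j hU) rfl
  refine ⟨V, hV, hVc, hVn.trans (card_filter_shiftFamily U i j d), hVw.trans ?_⟩
  rw [sum_shiftFamily]
  refine Finset.sum_le_sum fun e _ => ?_
  simp only [shiftPattern]
  split_ifs with h
  · exact patternWeight_swapEntries_le hij.ne (hmono hij.le) h.1 h.2.1
  · exact le_rfl

lemma patternSize_eq_card {m : ℕ} (c : Fin m → Bool) :
    patternSize c = (Finset.univ.filter fun i => c i = true).card := by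
  rw [patternSize, Finset.card_filter]
  exact Finset.sum_congr rfl fun i _ => by cases c i <;> rfl

/-- The patterns whose first `k` entries are all `true`. -/
def initialFamily (m k : ℕ) : Finset (Fin m → Bool) :=
  Finset.univ.filter fun c => ∀ i : Fin m, (i : ℕ) < k → c i = true

/-- The patterns whose first `k` entries are `true`, with a further `true` among the next `r`. -/
def starFamily (m k r : ℕ) : Finset (Fin m → Bool) :=
  (initialFamily m k).filter fun c => ∃ j : Fin m, k ≤ (j : ℕ) ∧ (j : ℕ) < k + r ∧ c j = true

lemma mem_initialFamily {m k : ℕ} {c : Fin m → Bool} :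
    c ∈ initialFamily m k ↔ ∀ i : Fin m, (i : ℕ) < k → c i = true := by
  simp [initialFamily]

lemma mem_starFamily {m k r : ℕ} {c : Fin m → Bool} :
    c ∈ starFamily m k r ↔ (∀ i : Fin m, (i : ℕ) < k → c i = true) ∧
      ∃ j : Fin m, k ≤ (j : ℕ) ∧ (j : ℕ) < k + r ∧ c j = true := by
  simp [starFamily, mem_initialFamily]

lemma mem_of_forall_imp {m : ℕ} {U : Finset (Fin m → Bool)}
    (hU : IsUpperSet (U : Set (Fin m → Bool))) {c e : Fin m → Bool} (hc : c ∈ U)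
    (h : ∀ i, c i = true → e i = true) : e ∈ U :=
  hU (fun i => Bool.le_iff_imp.2 (h i)) hc

lemma card_filter_val_lt {m k : ℕ} (hk : k ≤ m) :
    (Finset.univ.filter fun i : Fin m => (i : ℕ) < k).card = k := by
  rw [Fin.card_filter_val_lt, min_eq_right hk]

/-- The pattern with entries `true` in the first `k` positions and in position `j`. -/
def starPattern {m : ℕ} (k : ℕ) (j : Fin m) : Fin m → Bool :=
  fun i => decide ((i : ℕ) < k ∨ i = j)

lemma starPattern_apply {m k : ℕ} {j i : Fin m} :
    starPattern k j i = true ↔ (i : ℕ) < k ∨ i = j := by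
  simp [starPattern]

lemma eq_starPattern {m k : ℕ} {c : Fin m → Bool} (hsize : patternSize c ≤ k + 1)
    (hc : ∀ i : Fin m, (i : ℕ) < k → c i = true) {j : Fin m} (hkj : k ≤ (j : ℕ))
    (hj : c j = true) : c = starPattern k j := by
  classical
  rw [patternSize_eq_card] at hsize
  have hsub : insert j (Finset.univ.filter fun i : Fin m => (i : ℕ) < k) ⊆
      Finset.univ.filter fun i => c i = true := by
    intro i hi
    rcases Finset.mem_insert.1 hi with rfl | hi
    · simpa using hj
    · simpa using hc i (by simpa using hi)
  have hcard : (insert j (Finset.univ.filter fun i : Fin m => (i : ℕ) < k)).card = k + 1 := by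
    rw [Finset.card_insert_of_notMem (by simpa using hkj),
      card_filter_val_lt (hkj.trans j.2.le)]
  have heq := Finset.eq_of_subset_of_card_le hsub (hcard ▸ hsize)
  ext i
  have hi := congrArg (fun s => i ∈ s) heq
  simp only [Finset.mem_insert, Finset.mem_filter, Finset.mem_univ, true_and, eq_iff_iff] at hi
  rw [Bool.eq_iff_iff, starPattern_apply, ← hi, or_comm]

lemma starFamily_subset {m k r : ℕ} {U : Finset (Fin m → Bool)}
    (hU : IsUpperSet (U : Set (Fin m → Bool))) (hcomp : IsLeftCompressed U)
    (hcard : r ≤ (U.filter fun c => patternSize c ≤ k + 1).card)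
    (hinit : ∀ c ∈ U, patternSize c ≤ k + 1 → ∀ i : Fin m, (i : ℕ) < k → c i = true) :
    starFamily m k r ⊆ U := by
  classical
  intro t ht
  obtain ⟨htk, j, hkj, hjr, htj⟩ := mem_starFamily.1 ht
  suffices h : starPattern k j ∈ U by
    refine mem_of_forall_imp hU h fun i hi => ?_
    rcases starPattern_apply.1 hi with hi | rfl
    · exact htk i hi
    · exact htj
  by_contra hjU
  have hsub : (U.filter fun c => patternSize c ≤ k + 1) ⊆
      (Finset.Ico (⟨k, hkj.trans_lt j.2⟩ : Fin m) j).image (starPattern k) := by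
    intro c hc
    obtain ⟨hcU, hcs⟩ := Finset.mem_filter.1 hc
    have hck := hinit c hcU hcs
    obtain ⟨l, hkl, hl⟩ : ∃ l : Fin m, k ≤ (l : ℕ) ∧ c l = true := by
      by_contra hno
      refine hjU (mem_of_forall_imp hU hcU fun i hi => starPattern_apply.2 (Or.inl ?_))
      by_contra hki
      exact hno ⟨i, not_lt.1 hki, hi⟩
    have hcl := eq_starPattern hcs hck hkl hl
    refine Finset.mem_image.2 ⟨l, Finset.mem_Ico.2 ⟨hkl, ?_⟩, hcl.symm⟩
    by_contra hlj
    rcases (not_lt.1 hlj).eq_or_lt with rfl | hlj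
    · exact hjU (hcl ▸ hcU)
    · have hcj : c j = false := by
        rw [hcl, ← Bool.not_eq_true, starPattern_apply]
        rintro (h | h)
        · omega
        · exact hlj.ne h
      refine hjU (mem_of_forall_imp hU (hcomp j l hlj c hcU hl hcj) fun i hi => ?_)
      rw [starPattern_apply]
      by_cases hij : i = j
      · exact Or.inr hij
      by_cases hil : i = l
      · rw [hil, swapEntries_apply_right, hcj] at hi
        exact absurd hi (by decide)
      rw [swapEntries_apply_of_ne hij hil, hcl, starPattern_apply] at hi
      exact Or.inl (hi.resolve_right hil)
  have := (Finset.card_le_card hsub).trans Finset.card_image_le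
  rw [Fin.card_Ico] at this
  simp only at this
  omega

lemma exists_missing_only {m k : ℕ} (hk : k ≤ m) {U : Finset (Fin m → Bool)}
    (hU : IsUpperSet (U : Set (Fin m → Bool))) (hcomp : IsLeftCompressed U)
    {c : Fin m → Bool} (hc : c ∈ U) (hsize : patternSize c ≤ k + 1) {x : Fin m}
    (hcx : c x = false) :
    ∃ e ∈ U, patternSize e ≤ k + 1 ∧ e x = false ∧
      ∀ i : Fin m, (i : ℕ) < k → i ≠ x → e i = true := by
  classical
  obtain ⟨e, he, hmax⟩ := Finset.exists_max_image
    (U.filter fun e => patternSize e ≤ k + 1 ∧ e x = false)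
    (fun e => (Finset.univ.filter fun i : Fin m => (i : ℕ) < k ∧ e i = true).card)
    ⟨c, Finset.mem_filter.2 ⟨hc, hsize, hcx⟩⟩
  obtain ⟨heU, hes, hex⟩ := Finset.mem_filter.1 he
  refine ⟨e, heU, hes, hex, fun y hyk hyx => ?_⟩
  by_contra hey
  rw [Bool.not_eq_true] at hey
  suffices h : ∃ f ∈ U, patternSize f ≤ k + 1 ∧ f x = false ∧ f y = true ∧
      ∀ i : Fin m, (i : ℕ) < k → e i = true → f i = true by
    obtain ⟨f, hfU, hfs, hfx, hfy, hf⟩ := h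
    refine absurd (hmax f (Finset.mem_filter.2 ⟨hfU, hfs, hfx⟩)) (not_le.2 ?_)
    refine Finset.card_lt_card ((Finset.ssubset_iff_of_subset ?_).2 ⟨y, ?_, ?_⟩)
    · intro i hi
      simp only [Finset.mem_filter, Finset.mem_univ, true_and] at hi ⊢
      exact ⟨hi.1, hf i hi.1 hi.2⟩
    · simp [hyk, hfy]
    · simp [hey]
  by_cases hj : ∃ j : Fin m, k ≤ (j : ℕ) ∧ e j = true
  · obtain ⟨j, hkj, hj⟩ := hj
    have hyj : y < j := Fin.lt_def.2 (by omega)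
    have hxj : x ≠ j := by
      rintro rfl
      rw [hex] at hj
      exact absurd hj (by decide)
    refine ⟨swapEntries y j e, hcomp y j hyj e heU hj hey, ?_, ?_, ?_, ?_⟩
    · rwa [patternSize_swapEntries]
    · rwa [swapEntries_apply_of_ne hyx.symm hxj]
    · rwa [swapEntries_apply_left]
    · intro i hik hi
      have hij : i ≠ j := by
        rintro rfl
        omega
      have hiy : i ≠ y := by
        rintro rfl
        rw [hey] at hi
        exact absurd hi (by decide)
      rwa [swapEntries_apply_of_ne hiy hij]
  · have hup : ∀ i, e i = true → Function.update e y true i = true := by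
      intro i hi
      by_cases hiy : i = y
      · rw [hiy, Function.update_self]
      · rwa [Function.update_of_ne hiy]
    refine ⟨Function.update e y true, mem_of_forall_imp hU heU hup, ?_, ?_, ?_, fun i _ => hup i⟩
    · rw [patternSize_eq_card]
      refine (Finset.card_le_card (t := Finset.univ.filter fun i : Fin m => (i : ℕ) < k)
        fun i hi => ?_).trans ((card_filter_val_lt hk).le.trans k.le_succ)
      simp only [Finset.mem_filter, Finset.mem_univ, true_and] at hi ⊢
      by_cases hiy : i = y
      · rwa [hiy]
      · rw [Function.update_of_ne hiy] at hi
        by_contra hik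
        exact hj ⟨i, not_lt.1 hik, hi⟩
    · rwa [Function.update_of_ne hyx.symm]
    · rw [Function.update_self]

lemma exists_pair_pattern {m k : ℕ} (hk : k + 2 ≤ m) {U : Finset (Fin m → Bool)}
    (hU : IsUpperSet (U : Set (Fin m → Bool))) {e : Fin m → Bool} (he : e ∈ U)
    (hsize : patternSize e ≤ k + 1) {x : Fin m} (hxk : (x : ℕ) < k) (hex : e x = false)
    (hek : ∀ i : Fin m, (i : ℕ) < k → i ≠ x → e i = true) :
    ∃ y z : Fin m, k ≤ (y : ℕ) ∧ k ≤ (z : ℕ) ∧ y ≠ z ∧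
      (fun i : Fin m => decide (((i : ℕ) < k ∧ i ≠ x) ∨ i = y ∨ i = z)) ∈ U := by
  classical
  set J := Finset.univ.filter fun i : Fin m => k ≤ (i : ℕ) ∧ e i = true with hJ
  set K := Finset.univ.filter fun i : Fin m => k ≤ (i : ℕ) with hK
  set I := (Finset.univ.filter fun i : Fin m => (i : ℕ) < k) with hI
  have hIcard : I.card = k := card_filter_val_lt (by omega)
  have hKcard : 2 ≤ K.card := by
    have h := Finset.card_filter_add_card_filter_not (s := (Finset.univ : Finset (Fin m)))
      (fun i : Fin m => (i : ℕ) < k)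
    simp only [not_lt, Finset.card_univ, Fintype.card_fin] at h
    have hIK : I.card + K.card = m := by convert h
    omega
  have hJcard : J.card ≤ 2 := by
    have hdisj : Disjoint J (I.erase x) := by
      rw [Finset.disjoint_left]
      intro i hi hi'
      simp only [hJ, hI, Finset.mem_filter, Finset.mem_erase, Finset.mem_univ, true_and] at hi hi'
      omega
    have hsub : J ∪ I.erase x ⊆ Finset.univ.filter fun i => e i = true := by
      intro i hi
      simp only [hJ, hI, Finset.mem_union, Finset.mem_filter, Finset.mem_erase, Finset.mem_univ,
        true_and] at hi ⊢
      rcases hi with hi | hi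
      · exact hi.2
      · exact hek i hi.2 hi.1
    have h := Finset.card_le_card hsub
    rw [Finset.card_union_of_disjoint hdisj,
      Finset.card_erase_of_mem (by simpa [hI] using hxk), hIcard, ← patternSize_eq_card] at h
    omega
  obtain ⟨L, hJL, hLK, hL⟩ := Finset.exists_subsuperset_card_eq
    (Finset.monotone_filter_right _ fun i _ (hi : k ≤ (i : ℕ) ∧ e i = true) => hi.1 : J ⊆ K)
    hJcard hKcard
  obtain ⟨y, z, hyz, rfl⟩ := Finset.card_eq_two.1 hL
  have hy : y ∈ K := hLK (by simp)
  have hz : z ∈ K := hLK (by simp)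
  refine ⟨y, z, by simpa [hK] using hy, by simpa [hK] using hz, hyz,
    mem_of_forall_imp hU he fun i hi => ?_⟩
  rw [decide_eq_true_iff]
  by_cases hik : (i : ℕ) < k
  · refine Or.inl ⟨hik, ?_⟩
    rintro rfl
    rw [hex] at hi
    exact absurd hi (by decide)
  · exact Or.inr (by simpa using hJL (show i ∈ J by simpa [hJ, hi] using hik))

lemma patternWeight_le_of_exchange {m : ℕ} {n : Fin m → ℕ} (hn : ∀ i, 2 ≤ n i)
    {x y z : Fin m} (hxy : x ≠ y) (hxz : x ≠ z) (hyz : y ≠ z) (hle : n x ≤ n y)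
    {c e : Fin m → Bool} (hcy : c y = false) (hcz : c z = false)
    (hex : e x = false) (hey : e y = true) (hez : e z = true)
    (hce : ∀ i, i ≠ x → i ≠ y → i ≠ z → c i = e i) :
    patternWeight n c ≤ patternWeight n e := by
  have split : ∀ f : Fin m → Bool, patternWeight n f =
      (bif f x then n x - 1 else 1) * ((bif f y then n y - 1 else 1) *
        ((bif f z then n z - 1 else 1) *
          ∏ k ∈ ((Finset.univ.erase x).erase y).erase z, bif f k then n k - 1 else 1)) :=
    fun f => by
      rw [patternWeight, ← Finset.mul_prod_erase _ _ (Finset.mem_univ x),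
        ← Finset.mul_prod_erase _ _ (Finset.mem_erase.2 ⟨hxy.symm, Finset.mem_univ y⟩),
        ← Finset.mul_prod_erase _ _ (Finset.mem_erase.2 ⟨hyz.symm, Finset.mem_erase.2
          ⟨hxz.symm, Finset.mem_univ z⟩⟩)]
  have hrest : ∏ k ∈ ((Finset.univ.erase x).erase y).erase z, (bif c k then n k - 1 else 1) =
      ∏ k ∈ ((Finset.univ.erase x).erase y).erase z, bif e k then n k - 1 else 1 := by
    refine Finset.prod_congr rfl fun k hk => ?_
    simp only [Finset.mem_erase] at hk
    rw [hce k hk.2.2.1 hk.2.1 hk.1]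
  rw [split, split e, hrest, hcy, hcz, hex, hey, hez]
  simp only [cond_true, cond_false, one_mul]
  have hx := hn x
  have hz := hn z
  have h1 : (bif c x then n x - 1 else 1) ≤ n y - 1 := by
    cases c x <;> simp <;> omega
  refine Nat.mul_le_mul h1 (Nat.le_mul_of_pos_left _ (by omega))

lemma sum_initialFamily_le {m k : ℕ} {n : Fin m → ℕ} (hn : ∀ i, 2 ≤ n i) (hmono : Monotone n)
    {U : Finset (Fin m → Bool)} (hU : IsUpperSet (U : Set (Fin m → Bool)))
    (hcomp : IsLeftCompressed U) {x y z : Fin m} (hxk : (x : ℕ) < k) (hky : k ≤ (y : ℕ))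
    (hkz : k ≤ (z : ℕ)) (hyz : y ≠ z)
    (hpair : (fun i : Fin m => decide (((i : ℕ) < k ∧ i ≠ x) ∨ i = y ∨ i = z)) ∈ U) :
    ∑ c ∈ initialFamily m k, patternWeight n c ≤ ∑ c ∈ U, patternWeight n c := by
  classical
  set p : Fin m → Bool := fun i => decide (((i : ℕ) < k ∧ i ≠ x) ∨ i = y ∨ i = z) with hp
  have hxy : x < y := Fin.lt_def.2 (by omega)
  have hxz : x < z := Fin.lt_def.2 (by omega)
  have hpx : p x = false := by simp [hp, hxy.ne, hxz.ne]
  have hpy : p y = true := by simp [hp]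
  have hpz : p z = true := by simp [hp]
  have hstar : ∀ u v : Fin m, u ≠ v → x < u → p u = true →
      (∀ i, p i = true → ((i : ℕ) < k ∧ i ≠ x) ∨ i = u ∨ i = v) →
      ∀ c ∈ initialFamily m k, c v = true → c ∈ U := by
    intro u v huv hxu hpu hp' c hc hcv
    refine mem_of_forall_imp hU (hcomp x u hxu p hpair hpu hpx) fun i hi => ?_
    by_cases hix : i = x
    · exact hix ▸ mem_initialFamily.1 hc x hxk
    by_cases hiu : i = u
    · rw [hiu, swapEntries_apply_right, hpx] at hi
      exact absurd hi (by decide)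
    rw [swapEntries_apply_of_ne hix hiu] at hi
    rcases hp' i hi with h | h | h
    · exact mem_initialFamily.1 hc i h.1
    · exact absurd h hiu
    · exact h ▸ hcv
  set g : (Fin m → Bool) → (Fin m → Bool) := fun c i =>
    if i = x then false else if i = y ∨ i = z then true else c i with hg
  have hoff : ∀ c ∈ initialFamily m k \ U, c x = true ∧ c y = false ∧ c z = false := by
    intro c hc
    obtain ⟨hc, hcU⟩ := Finset.mem_sdiff.1 hc
    refine ⟨mem_initialFamily.1 hc x hxk, ?_, ?_⟩
    · by_contra h
      exact hcU (hstar z y hyz.symm hxz hpz (fun i hi => by simp [hp] at hi; tauto) c hc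
        (by simpa using h))
    · by_contra h
      exact hcU (hstar y z hyz hxy hpy (fun i hi => by simpa [hp] using hi) c hc
        (by simpa using h))
  have hginj : Set.InjOn g (initialFamily m k \ U : Finset (Fin m → Bool)) := by
    intro c hc e he h
    obtain ⟨hcx, hcy, hcz⟩ := hoff c hc
    obtain ⟨hex, hey, hez⟩ := hoff e he
    ext i
    by_cases hix : i = x
    · rw [hix, hcx, hex]
    by_cases hiy : i = y
    · rw [hiy, hcy, hey]
    by_cases hiz : i = z
    · rw [hiz, hcz, hez]
    simpa [hg, hix, hiy, hiz] using congrFun h i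
  have hgU : (initialFamily m k \ U).image g ⊆ U \ initialFamily m k := by
    intro e he
    obtain ⟨c, hc, rfl⟩ := Finset.mem_image.1 he
    refine Finset.mem_sdiff.2 ⟨mem_of_forall_imp hU hpair fun i hi => ?_, fun h => ?_⟩
    · have hix : i ≠ x := by
        rintro rfl
        rw [hpx] at hi
        exact absurd hi (by decide)
      by_cases hiyz : i = y ∨ i = z
      · simp [hg, hix, hiyz]
      · have := mem_initialFamily.1 (Finset.mem_sdiff.1 hc).1 i
        simp [hp] at hi
        simp only [hg, hix, hiyz, if_false]
        tauto
    · have := mem_initialFamily.1 h x hxk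
      simp [hg] at this
  have hle : ∑ c ∈ initialFamily m k \ U, patternWeight n c ≤
      ∑ c ∈ U \ initialFamily m k, patternWeight n c :=
    calc _ ≤ ∑ c ∈ initialFamily m k \ U, patternWeight n (g c) := by
          refine Finset.sum_le_sum fun c hc => ?_
          obtain ⟨hcx, hcy, hcz⟩ := hoff c hc
          exact patternWeight_le_of_exchange hn hxy.ne hxz.ne hyz (hmono hxy.le) hcy hcz
            (by simp [hg]) (by simp [hg, hxy.ne']) (by simp [hg, hxz.ne'])
            (fun i h1 h2 h3 => by simp [hg, h1, h2, h3])
      _ = ∑ e ∈ (initialFamily m k \ U).image g, patternWeight n e :=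
          (Finset.sum_image hginj).symm
      _ ≤ _ := Finset.sum_le_sum_of_subset hgU
  rw [← Finset.sum_inter_add_sum_sdiff (initialFamily m k) U,
    ← Finset.sum_inter_add_sum_sdiff U (initialFamily m k), Finset.inter_comm U]
  exact Nat.add_le_add_left hle _

/-- Among the upper sets with at least `r` patterns of size at most `k + 1`, the star has the
least weight. -/
theorem sum_starFamily_le {m k r : ℕ} {n : Fin m → ℕ} (hn : ∀ i, 2 ≤ n i) (hmono : Monotone n)
    (hr : 1 ≤ r) (hkr : k + r ≤ m) {U : Finset (Fin m → Bool)}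
    (hU : IsUpperSet (U : Set (Fin m → Bool)))
    (hcard : r ≤ (U.filter fun c => patternSize c ≤ k + 1).card) :
    ∑ c ∈ starFamily m k r, patternWeight n c ≤ ∑ c ∈ U, patternWeight n c := by
  obtain ⟨V, hV, hcomp, hVcard, hVw⟩ := exists_isLeftCompressed hmono (k + 1) U hU
  rw [← hVcard] at hcard
  refine le_trans ?_ hVw
  by_cases hinit : ∀ c ∈ V, patternSize c ≤ k + 1 → ∀ i : Fin m, (i : ℕ) < k → c i = true
  · exact Finset.sum_le_sum_of_subset (starFamily_subset hV hcomp hcard hinit)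
  push Not at hinit
  obtain ⟨c, hc, hcs, x, hxk, hcx⟩ := hinit
  by_cases hm : k + 2 ≤ m
  · obtain ⟨e, he, hes, hex, hek⟩ :=
      exists_missing_only (by omega) hV hcomp hc hcs (by simpa using hcx)
    obtain ⟨y, z, hky, hkz, hyz, hpair⟩ := exists_pair_pattern hm hV he hes hxk hex hek
    exact (Finset.sum_le_sum_of_subset (Finset.filter_subset _ _)).trans
      (sum_initialFamily_le hn hmono hV hcomp hxk hky hkz hyz hpair)
  · refine Finset.sum_le_sum_of_subset fun t ht => ?_
    obtain ⟨htk, j, hkj, hjr, htj⟩ := mem_starFamily.1 ht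
    refine mem_of_forall_imp hV hc fun i _ => ?_
    by_cases hik : (i : ℕ) < k
    · exact htk i hik
    · have : i = j := Fin.ext (by omega)
      rwa [this]

lemma mem_codeSupp {F ι : Type*} [Field F] [Fintype ι] {C : Submodule F (ι → F)} {i : ι} :
    i ∈ codeSupp C ↔ ∃ c ∈ C, c i ≠ 0 := by
  simp [codeSupp]

lemma sum_piFinset_patternWeight {m : ℕ} (n : Fin m → ℕ) (t : Fin m → Finset Bool) :
    ∑ c ∈ Fintype.piFinset t, patternWeight n c =
      ∏ i, ∑ b ∈ t i, bif b then n i - 1 else 1 :=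
  (Finset.prod_univ_sum t fun i b => bif b then n i - 1 else 1).symm

lemma sum_starFamily {m k r : ℕ} {n : Fin m → ℕ} (hn : ∀ i, 1 ≤ n i) :
    ∑ c ∈ starFamily m k r, patternWeight n c =
      (∏ i : Fin m, if (i : ℕ) < k then n i - 1 else n i) -
        ∏ i : Fin m, if (i : ℕ) < k then n i - 1 else if (i : ℕ) < k + r then 1 else n i := by
  classical
  have hall : initialFamily m k =
      Fintype.piFinset fun i : Fin m => if (i : ℕ) < k then {true} else Finset.univ := by
    ext c
    rw [mem_initialFamily, Fintype.mem_piFinset]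
    refine forall_congr' fun i => ?_
    split_ifs with h <;> simp [h]
  have hoff : (initialFamily m k).filter (fun c => ¬ ∃ j : Fin m, k ≤ (j : ℕ) ∧
      (j : ℕ) < k + r ∧ c j = true) = Fintype.piFinset fun i : Fin m =>
        if (i : ℕ) < k then {true} else if (i : ℕ) < k + r then {false} else Finset.univ := by
    ext c
    rw [Finset.mem_filter, mem_initialFamily, Fintype.mem_piFinset, not_exists, ← forall_and]
    refine forall_congr' fun i => ?_
    split_ifs with h h'
    · simp [h]
    · have : k ≤ (i : ℕ) := not_lt.1 h
      simp [h', this]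
    · simp [h, h']
  have hsum := Finset.sum_filter_add_sum_filter_not (initialFamily m k)
    (fun c => ∃ j : Fin m, k ≤ (j : ℕ) ∧ (j : ℕ) < k + r ∧ c j = true) (patternWeight n)
  rw [hoff, hall, sum_piFinset_patternWeight, sum_piFinset_patternWeight, ← hall] at hsum
  have hone : ∀ i, n i - 1 + 1 = n i := fun i => Nat.sub_add_cancel (hn i)
  refine Nat.eq_sub_of_add_eq (Eq.trans ?_ (hsum.trans ?_))
  · refine congrArg _ (Finset.prod_congr rfl fun i _ => ?_)
    split_ifs <;> simp [hone]
  · refine Finset.prod_congr rfl fun i _ => ?_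
    split_ifs <;> simp [hone]

lemma card_star_points {F : Type*} [DecidableEq F] {m k r : ℕ} {A : Fin m → Finset F}
    {a : Fin m → F} (ha : ∀ i, a i ∈ A i) :
    ((Fintype.piFinset A).filter fun P => (∀ i : Fin m, (i : ℕ) < k → P i ≠ a i) ∧
        ∃ j : Fin m, k ≤ (j : ℕ) ∧ (j : ℕ) < k + r ∧ P j ≠ a j).card =
      (∏ i : Fin m, if (i : ℕ) < k then (A i).card - 1 else (A i).card) -
        ∏ i : Fin m, if (i : ℕ) < k then (A i).card - 1
          else if (i : ℕ) < k + r then 1 else (A i).card := by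
  have hall : (Fintype.piFinset A).filter (fun P => ∀ i : Fin m, (i : ℕ) < k → P i ≠ a i) =
      Fintype.piFinset fun i : Fin m => if (i : ℕ) < k then (A i).erase (a i) else A i := by
    ext P
    rw [Finset.mem_filter, Fintype.mem_piFinset, Fintype.mem_piFinset, ← forall_and]
    refine forall_congr' fun i => ?_
    split_ifs with h <;> simp [h, and_comm]
  have hoff : ((Fintype.piFinset A).filter (fun P => ∀ i : Fin m, (i : ℕ) < k → P i ≠ a i)).filter
      (fun P => ¬ ∃ j : Fin m, k ≤ (j : ℕ) ∧ (j : ℕ) < k + r ∧ P j ≠ a j) =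
      Fintype.piFinset fun i : Fin m => if (i : ℕ) < k then (A i).erase (a i)
        else if (i : ℕ) < k + r then {a i} else A i := by
    ext P
    rw [Finset.mem_filter, Finset.mem_filter, Fintype.mem_piFinset, Fintype.mem_piFinset,
      not_exists, ← forall_and, ← forall_and]
    refine forall_congr' fun i => ?_
    have hai := ha i
    split_ifs with h h'
    · have : ¬ k ≤ (i : ℕ) := not_le.2 h
      simp [h, this, and_comm]
    · have : k ≤ (i : ℕ) := not_lt.1 h
      simp only [h, h', this, Finset.mem_singleton, true_and, not_not, false_imp_iff, and_true]
      exact ⟨fun hP => hP.2, fun hP => ⟨hP ▸ hai, hP⟩⟩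
    · simp [h, h']
  have hsum := Finset.card_filter_add_card_filter_not
    (s := (Fintype.piFinset A).filter (fun P => ∀ i : Fin m, (i : ℕ) < k → P i ≠ a i))
    (fun P => ∃ j : Fin m, k ≤ (j : ℕ) ∧ (j : ℕ) < k + r ∧ P j ≠ a j)
  rw [hoff, hall, Fintype.card_piFinset, Fintype.card_piFinset, ← hall, Finset.filter_filter]
    at hsum
  simp only [apply_ite Finset.card, Finset.card_singleton,
    Finset.card_erase_of_mem (ha _)] at hsum
  exact Nat.eq_sub_of_add_eq hsum

lemma prod_fin_three_ranges {m k r : ℕ} (hkr : k + r ≤ m) (f g h : ℕ → ℕ) :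
    (∏ i : Fin m, if (i : ℕ) < k then f (i + 1) else if (i : ℕ) < k + r then g (i + 1)
        else h (i + 1)) =
      (∏ i ∈ Finset.Icc 1 k, f i) * (∏ i ∈ Finset.Icc (k + 1) (k + r), g i) *
        ∏ i ∈ Finset.Icc (k + r + 1) m, h i := by
  rw [Fin.prod_univ_eq_prod_range (fun i => if i < k then f (i + 1) else if i < k + r
    then g (i + 1) else h (i + 1)) m, Finset.range_eq_Ico,
    ← Finset.prod_Ico_consecutive _ (Nat.zero_le (k + r)) hkr,
    ← Finset.prod_Ico_consecutive _ (Nat.zero_le k) (Nat.le_add_right k r)]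
  simp only [← Finset.Ico_add_one_right_eq_Icc]
  rw [← Finset.prod_Ico_add' h, ← Finset.prod_Ico_add' g, ← zero_add 1, ← Finset.prod_Ico_add' f]
  congr 1
  · congr 1
    · refine Finset.prod_congr rfl fun i hi => if_pos (Finset.mem_Ico.1 hi).2
    · refine Finset.prod_congr rfl fun i hi => ?_
      have := Finset.mem_Ico.1 hi
      rw [if_neg (by omega), if_pos this.2]
  · refine Finset.prod_congr rfl fun i hi => ?_
    have := Finset.mem_Ico.1 hi
    rw [if_neg (by omega), if_neg (by omega)]

lemma nval_val_add_one {F : Type*} {m : ℕ} (A : Fin m → Finset F) (i : Fin m) :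
    nval A (i + 1) = (A i).card := by
  have : 1 ≤ (i : ℕ) + 1 ∧ (i : ℕ) + 1 ≤ m := ⟨by omega, i.2⟩
  simp [nval, this]

lemma starWeight_eq {F : Type*} {m k r : ℕ} (hkr : k + r ≤ m) (A : Fin m → Finset F) :
    ((∏ i : Fin m, if (i : ℕ) < k then (A i).card - 1 else (A i).card) -
        ∏ i : Fin m, if (i : ℕ) < k then (A i).card - 1
          else if (i : ℕ) < k + r then 1 else (A i).card) =
      (∏ i ∈ Finset.Icc 1 k, (nval A i - 1)) * (∏ i ∈ Finset.Icc (k + r + 1) m, nval A i) *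
        ((∏ i ∈ Finset.Icc (k + 1) (k + r), nval A i) - 1) := by
  have h1 := prod_fin_three_ranges hkr (fun i => nval A i - 1) (nval A) (nval A)
  have h2 := prod_fin_three_ranges hkr (fun i => nval A i - 1) (fun _ => 1) (nval A)
  simp only [nval_val_add_one, ite_self, Finset.prod_const_one, mul_one] at h1 h2
  rw [h1, h2, Nat.mul_sub, mul_one]
  congr 1
  ring

lemma prod_sub_mem_evalCodeX {F : Type*} [Field F] {m d : ℕ} (A : Fin m → Finset F)
    (a : Fin m → F) {s : Finset (Fin m)} (hs : s.card ≤ d) :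
    (fun P : {P : Fin m → F // ∀ i, P i ∈ A i} => ∏ i ∈ s, (P.1 i - a i)) ∈
      evalCodeX A (Sle m d) := by
  classical
  have heq : (fun P : {P : Fin m → F // ∀ i, P i ∈ A i} => ∏ i ∈ s, (P.1 i - a i)) =
      ∑ t ∈ s.powerset, (∏ i ∈ s \ t, -a i) •
        fun P : {P : Fin m → F // ∀ i, P i ∈ A i} =>
          ∏ i, P.1 i ^ (if i ∈ t then 1 else 0) := by
    ext P
    simp only [sub_eq_add_neg, Finset.prod_add, Finset.sum_apply, Pi.smul_apply, smul_eq_mul,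
      pow_ite, pow_one, pow_zero, Finset.prod_ite_mem, Finset.univ_inter]
    exact Finset.sum_congr rfl fun t _ => mul_comm _ _
  rw [heq]
  refine Submodule.sum_mem _ fun t ht => Submodule.smul_mem _ _ (Submodule.subset_span
    ⟨fun i => if i ∈ t then 1 else 0, ⟨fun i => ?_, ?_⟩, rfl⟩)
  · dsimp only
    split_ifs <;> simp
  · simpa using (Finset.card_le_card (Finset.mem_powerset.1 ht)).trans hs

/-- A subcode of dimension `r` whose support consists of the points counted by the star. -/
lemma exists_subcode {F : Type*} [Field F] [Fintype F] [DecidableEq F] {m k r : ℕ}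
    (hkr : k + r ≤ m) (A : Fin m → Finset F) (hA : ∀ i, 2 ≤ (A i).card) :
    ∃ C : Submodule F ({P : Fin m → F // ∀ i, P i ∈ A i} → F),
      C ≤ evalCodeX A (Sle m (k + 1)) ∧ Module.finrank F C = r ∧
      (codeSupp C).card = (∏ i : Fin m, if (i : ℕ) < k then (A i).card - 1 else (A i).card) -
        ∏ i : Fin m, if (i : ℕ) < k then (A i).card - 1
          else if (i : ℕ) < k + r then 1 else (A i).card := by
  have hpair : ∀ i, ∃ x ∈ A i, ∃ y ∈ A i, x ≠ y := fun i => Finset.one_lt_card.1 (hA i)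
  choose a ha b hb hab using hpair
  let pos : Fin r → Fin m := fun j => ⟨k + j, by omega⟩
  have hpos : Function.Injective pos := fun i j h => Fin.ext (by simpa [pos] using h)
  let I : Finset (Fin m) := Finset.univ.filter fun i => (i : ℕ) < k
  have hposI : ∀ j, pos j ∉ I := fun j => by simp [pos, I]
  let v : Fin r → {P : Fin m → F // ∀ i, P i ∈ A i} → F :=
    fun j P => ∏ i ∈ insert (pos j) I, (P.1 i - a i)
  have hv : ∀ j P, v j P ≠ 0 ↔ (∀ i : Fin m, (i : ℕ) < k → P.1 i ≠ a i) ∧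
      P.1 (pos j) ≠ a (pos j) := by
    intro j P
    simp only [v, Finset.prod_ne_zero_iff, sub_ne_zero, Finset.forall_mem_insert, I,
      Finset.mem_filter, Finset.mem_univ, true_and]
    exact and_comm
  have hli : LinearIndependent F v := by
    rw [Fintype.linearIndependent_iff]
    intro g hg j
    let P : {P : Fin m → F // ∀ i, P i ∈ A i} :=
      ⟨fun i => if (i : ℕ) < k ∨ i = pos j then b i else a i, fun i => by
        dsimp only
        split_ifs
        · exact hb i
        · exact ha i⟩
    have hP : ∀ l, l ≠ j → v l P = 0 := by
      intro l hl
      by_contra h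
      refine ((hv l P).1 h).2 (if_neg ?_)
      rintro (h' | h')
      · exact hposI l (by simpa [I] using h')
      · exact hl (hpos h')
    have hPj : v j P ≠ 0 := by
      refine (hv j P).2 ⟨fun i hi => ?_, ?_⟩
      · simpa [P, hi] using (hab i).symm
      · simpa [P] using (hab (pos j)).symm
    have h := congrFun hg P
    rw [Finset.sum_apply, Finset.sum_eq_single j (fun l _ hl => by simp [hP l hl])
      (fun h => absurd (Finset.mem_univ j) h)] at h
    exact (mul_eq_zero.1 h).resolve_right hPj
  refine ⟨Submodule.span F (Set.range v), ?_, ?_, ?_⟩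
  · rw [Submodule.span_le]
    rintro _ ⟨j, rfl⟩
    refine prod_sub_mem_evalCodeX A a ?_
    rw [Finset.card_insert_of_notMem (hposI j), card_filter_val_lt (by omega)]
  · rw [finrank_span_eq_card hli, Fintype.card_fin]
  · rw [← card_star_points ha]
    refine Finset.card_bij (fun P _ => P.1) (fun P hP => ?_) (fun P _ Q _ h => Subtype.ext h)
      fun P hP => ?_
    · obtain ⟨c, hc, hcP⟩ := mem_codeSupp.1 hP
      obtain ⟨j, hj⟩ : ∃ j, v j P ≠ 0 := by
        by_contra! hno
        have hle : Submodule.span F (Set.range v) ≤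
            LinearMap.ker (LinearMap.proj (R := F) (φ := fun _ => F) P) := by
          rw [Submodule.span_le]
          rintro _ ⟨j, rfl⟩
          exact hno j
        exact hcP (hle hc)
      obtain ⟨h1, h2⟩ := (hv j P).1 hj
      exact Finset.mem_filter.2 ⟨Fintype.mem_piFinset.2 P.2, h1, pos j, by simp [pos],
        by simp [pos], h2⟩
    · obtain ⟨hPA, h1, j, hkj, hjr, hj⟩ := Finset.mem_filter.1 hP
      refine ⟨⟨P, Fintype.mem_piFinset.1 hPA⟩, mem_codeSupp.2
        ⟨v ⟨j - k, by omega⟩, Submodule.subset_span ⟨_, rfl⟩, (hv _ _).2 ⟨h1, ?_⟩⟩, rfl⟩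
      have : pos ⟨j - k, by omega⟩ = j := Fin.ext (by simp [pos]; omega)
      rwa [this]

/-- The coefficient vectors of degree at most `d`. -/
def degreeLE (F : Type*) [Field F] (m d : ℕ) : Submodule F ((Fin m → Bool) → F) where
  carrier := {f | ∀ c, d < patternSize c → f c = 0}
  add_mem' hf hg c hc := by simp [hf c hc, hg c hc]
  zero_mem' _ _ := rfl
  smul_mem' t f hf c hc := by simp [hf c hc]

lemma evalCodeX_le_map {F : Type*} [Field F] {m d : ℕ} (A : Fin m → Finset F) :
    evalCodeX A (Sle m d) ≤ (degreeLE F m d).map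
      (LinearMap.funLeft F F (Subtype.val : {P : Fin m → F // ∀ i, P i ∈ A i} → Fin m → F) ∘ₗ
        multilinearEval F m) := by
  classical
  rw [evalCodeX, Submodule.span_le]
  rintro _ ⟨α, ⟨hα1, hαd⟩, rfl⟩
  have hα : ∀ i, (decide (α i = 1)).toNat = α i := fun i => by
    have := hα1 i
    interval_cases α i <;> rfl
  refine ⟨Pi.single (fun i => decide (α i = 1)) 1, fun c hc => ?_, ?_⟩
  · refine Pi.single_eq_of_ne ?_ _
    rintro rfl
    simp only [patternSize, hα] at hc
    omega
  · ext P
    simp [LinearMap.funLeft_apply, multilinearEval_apply, Pi.single_apply, hα]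

lemma le_card_codeSupp {F : Type*} [Field F] [Fintype F] [DecidableEq F] {m k r : ℕ}
    (hr : 1 ≤ r) (hkr : k + r ≤ m) (A : Fin m → Finset F) (hA : ∀ i, 2 ≤ (A i).card)
    (hmono : Monotone fun i => (A i).card)
    {C : Submodule F ({P : Fin m → F // ∀ i, P i ∈ A i} → F)}
    (hC : C ≤ evalCodeX A (Sle m (k + 1))) (hCr : Module.finrank F C = r) :
    (∏ i : Fin m, if (i : ℕ) < k then (A i).card - 1 else (A i).card) -
        (∏ i : Fin m, if (i : ℕ) < k then (A i).card - 1
          else if (i : ℕ) < k + r then 1 else (A i).card) ≤ (codeSupp C).card := by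
  classical
  set φ := LinearMap.funLeft F F
    (Subtype.val : {P : Fin m → F // ∀ i, P i ∈ A i} → Fin m → F) ∘ₗ multilinearEval F m
  set W := C.comap φ ⊓ degreeLE F m (k + 1)
  have hCW : C ≤ W.map φ := fun c hc => by
    obtain ⟨f, hf, rfl⟩ := evalCodeX_le_map A (hC hc)
    exact ⟨f, ⟨hc, hf⟩, rfl⟩
  have hrank : r ≤ Nat.card (leadingExponents W) :=
    hCr ▸ (Submodule.finrank_mono hCW).trans ((Submodule.finrank_map_le φ W).trans
      (finrank_le_card_leadingExponents W))
  have hcard : r ≤ ((exponentShadow W).filter fun c => patternSize c ≤ k + 1).card := by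
    rw [Nat.card_eq_card_toFinset] at hrank
    refine hrank.trans (Finset.card_le_card fun c hc => ?_)
    rw [Set.mem_toFinset] at hc
    refine Finset.mem_filter.2 ⟨mem_exponentShadow.2 ⟨c, hc, le_rfl⟩, ?_⟩
    obtain ⟨f, hf, hfc, -⟩ := hc
    by_contra hlt
    exact hfc (hf.2 c (not_le.1 hlt))
  rw [← sum_starFamily fun i => (hA i).trans' one_le_two]
  refine (sum_starFamily_le hA hmono hr hkr (isUpperSet_exponentShadow W) hcard).trans
    ((sum_exponentShadow_le_card_evalSupport A
      (fun i => Finset.card_pos.1 (zero_lt_two.trans_le (hA i))) W).trans ?_)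
  refine (Finset.card_le_card (t := (codeSupp C).image Subtype.val) fun P hP => ?_).trans
    Finset.card_image_le
  obtain ⟨hPA, f, hf, hfP⟩ := mem_evalSupport.1 hP
  exact Finset.mem_image.2 ⟨⟨P, hPA⟩, mem_codeSupp.2 ⟨_, hf.1, hfP⟩, rfl⟩

/-- Let `1 ≤ d ≤ m`, `1 ≤ r ≤ m+1−d`, and assume the growth condition
`n_{d+r−1}·n_{d−1}·(n_i+n_j−1) ≤ n_i·n_j·(n_{d+r−1}+n_{d−1}−1)` for all
`d ≤ i < j ≤ d+r−2`. Then for any Cartesian set `X = A_1 × ⋯ × A_m` over `F_q`,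
`d_r(C_{≤d}^{X,S}) = ∏_{i=1}^{d−1}(n_i−1) · ∏_{i=d+r}^{m} n_i · (∏_{i=d}^{d+r−1} n_i − 1)`. -/
theorem ghw_cartesian_squarefree_leq_d_formula
    {F : Type*} [Field F] [Fintype F] [DecidableEq F] {m d r : ℕ}
    (A : Fin m → Finset F)
    (hcard : ∀ i, 2 ≤ (A i).card)
    (hmono : ∀ i j : Fin m, i ≤ j → (A i).card ≤ (A j).card)
    (hd1 : 1 ≤ d) (hdm : d ≤ m) (hr1 : 1 ≤ r) (hr2 : r ≤ m + 1 - d)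
    (hcond : ∀ i j : ℕ, d ≤ i → i < j → j ≤ d + r - 2 →
      nval A (d + r - 1) * nval A (d - 1) * (nval A i + nval A j - 1) ≤
        nval A i * nval A j * (nval A (d + r - 1) + nval A (d - 1) - 1)) :
    GHW (evalCodeX A (Sle m d)) r =
      (∏ i ∈ Finset.Icc 1 (d - 1), (nval A i - 1)) *
        (∏ i ∈ Finset.Icc (d + r) m, nval A i) *
        ((∏ i ∈ Finset.Icc d (d + r - 1), nval A i) - 1) := by
  obtain ⟨k, rfl⟩ : ∃ k, d = k + 1 := ⟨d - 1, by omega⟩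
  have hkr : k + r ≤ m := by omega
  rw [Nat.add_sub_cancel, show k + 1 + r = k + r + 1 by omega, Nat.add_sub_cancel,
    ← starWeight_eq hkr A]
  obtain ⟨C, hC, hCr, hCcard⟩ := exists_subcode hkr A hcard
  refine le_antisymm (Nat.sInf_le ⟨C, hC, hCr, hCcard⟩) (le_csInf ⟨_, C, hC, hCr, rfl⟩ ?_)
  rintro _ ⟨C', hC', hCr', rfl⟩
  exact le_card_codeSupp hr1 hkr A hcard hmono hC' hCr'
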